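/- arXiv:1904.07467 — 10 statements merged into one kernel-verified Lean document; each statement's English description precedes it below -/
import Mathlib

section
/- Let ℓ, r be natural numbers with 0 < ℓ ≤ r, and suppose f with ℓ ≤ f ≤ r satisfies padicValNat 2 x ≤ padicValNat 2 f for all x with ℓ ≤ x ≤ r. Then for every x with ℓ ≤ x ≤ r and x ≠ f one has padicValNat 2 x < padicValNat 2 f. In particular, the 2-fattest number of [ℓ..r] is unique: if g with ℓ ≤ g ≤ r also satisfies padicValNat 2 x ≤ padicValNat 2 g for all x in [ℓ..r], then g = f. -/
/-- Between two distinct positive integers of equal 2-adic valuation there is one of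
larger valuation. -/
theorem exists_padicValNat_two_lt_of_eq {a b : ℕ} (ha : 0 < a) (hab : a < b)
    (h : padicValNat 2 a = padicValNat 2 b) :
    ∃ x, a < x ∧ x < b ∧ padicValNat 2 a < padicValNat 2 x := by
  have hna := pow_succ_padicValNat_not_dvd (p := 2) ha.ne'
  have hda : 2 ^ padicValNat 2 a ∣ a := pow_padicValNat_dvd
  have hdb : 2 ^ padicValNat 2 a ∣ b := h ▸ pow_padicValNat_dvd
  have hnb : ¬2 ^ (padicValNat 2 a + 1) ∣ b :=
    h ▸ pow_succ_padicValNat_not_dvd (p := 2) (ha.trans hab).ne'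
  generalize padicValNat 2 a = k at *
  have hk : 0 < 2 ^ k := by positivity
  obtain ⟨c, rfl⟩ := hda
  obtain ⟨d, rfl⟩ := hdb
  rw [pow_succ, Nat.mul_dvd_mul_iff_left hk] at hna hnb
  have hcd : c < d := lt_of_mul_lt_mul_left hab hk.le
  refine ⟨2 ^ k * (c + 1), Nat.mul_lt_mul_of_pos_left (by omega) hk,
    Nat.mul_lt_mul_of_pos_left (by omega) hk, ?_⟩
  rw [← Nat.succ_le_iff, ← padicValNat_dvd_iff_le (by positivity), Nat.succ_eq_add_one,
    pow_succ, Nat.mul_dvd_mul_iff_left hk]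
  omega

/-- A 2-fattest number of an interval `[ℓ..r]` of positive integers is a strict
maximizer of the 2-adic valuation, and hence is unique. -/
theorem two_fattest_unique (ℓ r f : ℕ) (hℓ : 0 < ℓ) (hlr : ℓ ≤ r)
    (hfl : ℓ ≤ f) (hfr : f ≤ r)
    (hmax : ∀ x, ℓ ≤ x → x ≤ r → padicValNat 2 x ≤ padicValNat 2 f) :
    (∀ x, ℓ ≤ x → x ≤ r → x ≠ f → padicValNat 2 x < padicValNat 2 f) ∧
    (∀ g, ℓ ≤ g → g ≤ r →
      (∀ x, ℓ ≤ x → x ≤ r → padicValNat 2 x ≤ padicValNat 2 g) → g = f) := by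
  have hlt : ∀ x, ℓ ≤ x → x ≤ r → x ≠ f → padicValNat 2 x < padicValNat 2 f := by
    intro x hxl hxr hne
    refine (hmax x hxl hxr).lt_of_ne fun heq => ?_
    rcases hne.lt_or_gt with hlt | hlt
    · obtain ⟨y, hy, hy', hv⟩ := exists_padicValNat_two_lt_of_eq (by omega) hlt heq
      have := hmax y (by omega) (by omega)
      omega
    · obtain ⟨y, hy, hy', hv⟩ := exists_padicValNat_two_lt_of_eq (by omega) hlt heq.symm
      have := hmax y (by omega) (by omega)
      omega
  refine ⟨hlt, fun g hgl hgr hg => ?_⟩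
  by_contra hne
  exact (hlt g hgl hgr hne).not_ge (hg f hfl hfr)
end

section
/- Let ℓ, r be natural numbers with 0 < ℓ ≤ r, let k = Nat.log 2 ((ℓ-1) ^^^ r), and let f = 2^k * (r / 2^k) (that is, r with its k lowest binary digits replaced by zeros). Then ℓ ≤ f and f ≤ r. -/
/-- For `0 < ℓ ≤ r`, with `k = Nat.log 2 ((ℓ-1) ^^^ r)`, the number
`f = 2^k * (r / 2^k)` (that is, `r` with its `k` lowest binary digits cleared)
lies in the interval `[ℓ..r]`. -/
theorem fattest_formula_mem (ℓ r k f : ℕ) (hℓ : 0 < ℓ) (hlr : ℓ ≤ r)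
    (hk : k = Nat.log 2 ((ℓ - 1) ^^^ r)) (hf : f = 2 ^ k * (r / 2 ^ k)) :
    ℓ ≤ f ∧ f ≤ r := by
  have hx : (ℓ - 1) ^^^ r ≠ 0 := fun h ↦ by
    have := Nat.xor_eq_zero_iff.mp h
    omega
  have hpow : 2 ^ k ≤ (ℓ - 1) ^^^ r := hk ▸ Nat.pow_log_le_self 2 hx
  have hne : (ℓ - 1) / 2 ^ k ≠ r / 2 ^ k := fun h ↦ by
    have hpos := Nat.div_pos hpow (by positivity)
    rw [Nat.xor_div_two_pow, h, Nat.xor_self] at hpos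
    exact hpos.false
  have hlt : (ℓ - 1) / 2 ^ k < r / 2 ^ k :=
    lt_of_le_of_ne (Nat.div_le_div_right (by omega)) hne
  rw [Nat.div_lt_iff_lt_mul (by positivity), mul_comm, ← hf] at hlt
  exact ⟨by omega, hf ▸ Nat.mul_div_le r (2 ^ k)⟩
end

section
/- Let ℓ, r be natural numbers with 0 < ℓ ≤ r and let k = Nat.log 2 ((ℓ-1) ^^^ r). Then f = 2^k * (r / 2^k) is the unique multiple of 2^k in the interval [ℓ..r]: one has 2^k ∣ f, ℓ ≤ f ≤ r, and every natural number x with ℓ ≤ x ≤ r and 2^k ∣ x satisfies x = f. -/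
/-- If the highest set bit of `a ^^^ b` is at position `k`, where `a < b`, then the quotients of
`a` and `b` by `2 ^ k` are consecutive. -/
theorem Nat.div_two_pow_log_xor_eq_succ {a b : ℕ} (h : a < b) :
    b / 2 ^ Nat.log 2 (a ^^^ b) = a / 2 ^ Nat.log 2 (a ^^^ b) + 1 := by
  have hne : a ^^^ b ≠ 0 := fun h0 => h.ne (Nat.xor_eq_zero_iff.mp h0)
  have hle := Nat.pow_log_le_self 2 hne
  have hlt := Nat.lt_pow_succ_log_self one_lt_two (a ^^^ b)
  have hone : (a ^^^ b) / 2 ^ Nat.log 2 (a ^^^ b) = 1 :=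
    Nat.div_eq_of_lt_le (by simpa using hle) (by rw [pow_succ] at hlt; omega)
  generalize Nat.log 2 (a ^^^ b) = k at hone
  rw [Nat.xor_div_two_pow] at hone
  have hmono : a / 2 ^ k ≤ b / 2 ^ k := Nat.div_le_div_right h.le
  have hquot : a / 2 ^ k ≠ b / 2 ^ k := fun heq => by simp [heq] at hone
  have hhalf : a / 2 ^ k / 2 = b / 2 ^ k / 2 := by
    rw [← Nat.xor_eq_zero_iff, ← Nat.xor_div_two, hone]
  omega


/-- For `0 < ℓ ≤ r` and `k = Nat.log 2 ((ℓ-1) ^^^ r)`, the number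
`f = 2^k * (r / 2^k)` is the unique multiple of `2^k` in `[ℓ..r]`. -/
theorem unique_multiple_in_interval (ℓ r k f : ℕ) (hℓ : 0 < ℓ) (hlr : ℓ ≤ r)
    (hk : k = Nat.log 2 ((ℓ - 1) ^^^ r)) (hf : f = 2 ^ k * (r / 2 ^ k)) :
    2 ^ k ∣ f ∧ ℓ ≤ f ∧ f ≤ r ∧
      ∀ x, ℓ ≤ x → x ≤ r → 2 ^ k ∣ x → x = f := by
  have hpos : 0 < 2 ^ k := by positivity
  have hquot : r / 2 ^ k = (ℓ - 1) / 2 ^ k + 1 :=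
    hk ▸ Nat.div_two_pow_log_xor_eq_succ (by omega)
  subst hf
  refine ⟨dvd_mul_right _ _, ?_, Nat.mul_div_le r _, ?_⟩
  · have := Nat.lt_mul_div_succ (ℓ - 1) hpos
    rw [hquot]
    omega
  · rintro x hlx hxr ⟨c, rfl⟩
    have hcr : c ≤ r / 2 ^ k := (Nat.le_div_iff_mul_le hpos).mpr (by rwa [mul_comm])
    have hlc : (ℓ - 1) / 2 ^ k < c :=
      (Nat.div_lt_iff_lt_mul hpos).mpr (by rw [mul_comm]; omega)
    rw [show c = r / 2 ^ k by omega]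
end

section
/- Let ℓ, r be natural numbers with 0 < ℓ ≤ r, let k = Nat.log 2 ((ℓ-1) ^^^ r), and let f = 2^k * (r / 2^k) (r with its k lowest binary digits cleared). Then f is the 2-fattest number of [ℓ..r]: ℓ ≤ f ≤ r, and for every x with ℓ ≤ x ≤ r and x ≠ f one has padicValNat 2 x < padicValNat 2 f. This makes precise the paper's claim (citing Belazzougui et al.) that the 2-fattest number of [ℓ..r] can be computed in constant time from ℓ and r using the bitwise exclusive-OR and masking operations. -/
/-- If `a < r` and `k` is the position of the highest bit in which they differ, then above the `k`
lowest bits `a` and `r` are `2 * m` and `2 * m + 1`. -/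
theorem exists_div_two_pow_log_xor {a r : ℕ} (h : a < r) :
    ∃ m, a / 2 ^ Nat.log 2 (a ^^^ r) = 2 * m ∧ r / 2 ^ Nat.log 2 (a ^^^ r) = 2 * m + 1 := by
  have hne : a ^^^ r ≠ 0 := fun h0 => h.ne (Nat.xor_eq_zero_iff.mp h0)
  set k := Nat.log 2 (a ^^^ r) with hk
  have hone : a / 2 ^ k ^^^ r / 2 ^ k = 1 := by
    rw [← Nat.xor_div_two_pow]
    refine Nat.div_eq_of_lt_le ?_ ?_
    · simpa using Nat.pow_log_le_self 2 hne
    · have := Nat.lt_pow_succ_log_self one_lt_two (a ^^^ r)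
      rw [pow_succ, ← hk] at this
      omega
  have hhalf : a / 2 ^ k / 2 = r / 2 ^ k / 2 := by
    rw [← Nat.xor_eq_zero_iff, ← Nat.xor_div_two, hone]
  have hdiff : a / 2 ^ k ≠ r / 2 ^ k := fun h0 => by simp [h0] at hone
  have hle : a / 2 ^ k ≤ r / 2 ^ k := Nat.div_le_div_right h.le
  exact ⟨a / 2 ^ k / 2, by omega, by omega⟩

theorem padicValNat_two_pow_mul_odd (k m : ℕ) :
    padicValNat 2 (2 ^ k * (2 * m + 1)) = k := by
  rw [padicValNat.mul (by positivity) (by positivity), padicValNat.prime_pow,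
    padicValNat.eq_zero_of_not_dvd (by omega), add_zero]

/-- For `0 < ℓ ≤ r`, with `k = Nat.log 2 ((ℓ-1) ^^^ r)`, the number
`f = 2^k * (r / 2^k)` is the 2-fattest number of `[ℓ..r]`: it lies in the
interval and strictly maximizes the 2-adic valuation there. -/
theorem fattest_formula_is_two_fattest (ℓ r k f : ℕ) (hℓ : 0 < ℓ) (hlr : ℓ ≤ r)
    (hk : k = Nat.log 2 ((ℓ - 1) ^^^ r)) (hf : f = 2 ^ k * (r / 2 ^ k)) :
    ℓ ≤ f ∧ f ≤ r ∧
      ∀ x, ℓ ≤ x → x ≤ r → x ≠ f → padicValNat 2 x < padicValNat 2 f := by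
  obtain ⟨m, ha, hr⟩ := exists_div_two_pow_log_xor (show ℓ - 1 < r by omega)
  rw [← hk] at ha hr
  have hpos : 0 < 2 ^ k := by positivity
  have hval : padicValNat 2 f = k := by
    rw [hf, hr, padicValNat_two_pow_mul_odd]
  refine ⟨?_, hf ▸ Nat.mul_div_le r (2 ^ k), fun x hx hxr hxf => ?_⟩
  · have := Nat.lt_mul_div_succ (ℓ - 1) hpos
    rw [ha, ← hr, ← hf] at this
    omega
  · rw [hval]
    by_contra! hkx
    obtain ⟨c, rfl⟩ : 2 ^ k ∣ x := (pow_dvd_pow 2 hkx).trans pow_padicValNat_dvd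
    have hcr : c ≤ 2 * m + 1 := by
      rw [← hr, Nat.le_div_iff_mul_le hpos, mul_comm]
      exact hxr
    have hac : 2 * m < c := by
      rw [← ha, Nat.div_lt_iff_lt_mul hpos, mul_comm]
      omega
    exact hxf (by rw [hf, hr, show c = 2 * m + 1 by omega])
end

section
/- Let ℓ, r be natural numbers with 0 < ℓ ≤ r. Then the maximum value of padicValNat 2 over the interval [ℓ..r] equals Nat.log 2 ((ℓ-1) ^^^ r): there exists f with ℓ ≤ f ≤ r and padicValNat 2 f = Nat.log 2 ((ℓ-1) ^^^ r), and every x with ℓ ≤ x ≤ r satisfies padicValNat 2 x ≤ Nat.log 2 ((ℓ-1) ^^^ r). In particular, the 2-fattest number of [ℓ..r] has exactly Nat.log 2 ((ℓ-1) ^^^ r) trailing binary zeros. -/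
/-- The xor of `a ≤ b` reaches `2 ^ k` exactly when `a` and `b` lie in different dyadic blocks
of length `2 ^ k`. -/
theorem Nat.two_pow_le_xor_iff_div_lt_div {a b : ℕ} (hab : a ≤ b) (k : ℕ) :
    2 ^ k ≤ a ^^^ b ↔ a / 2 ^ k < b / 2 ^ k := by
  have hle : a / 2 ^ k ≤ b / 2 ^ k := Nat.div_le_div_right hab
  rw [← not_lt, ← Nat.div_eq_zero_iff_lt (by positivity), Nat.xor_div_two_pow, Nat.xor_eq_zero_iff]
  omega

/-- For `0 < ℓ ≤ r`, the maximum of the 2-adic valuation over the interval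
`[ℓ..r]` equals `Nat.log 2 ((ℓ-1) ^^^ r)`. -/
theorem max_valuation_eq_log_xor (ℓ r : ℕ) (hℓ : 0 < ℓ) (hlr : ℓ ≤ r) :
    (∃ f, ℓ ≤ f ∧ f ≤ r ∧ padicValNat 2 f = Nat.log 2 ((ℓ - 1) ^^^ r)) ∧
    (∀ x, ℓ ≤ x → x ≤ r → padicValNat 2 x ≤ Nat.log 2 ((ℓ - 1) ^^^ r)) := by
  have hab : ℓ - 1 ≤ r := by omega
  have hne : (ℓ - 1) ^^^ r ≠ 0 := by
    rw [Ne, Nat.xor_eq_zero_iff]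
    omega
  have upper : ∀ x, ℓ ≤ x → x ≤ r → padicValNat 2 x ≤ Nat.log 2 ((ℓ - 1) ^^^ r) := by
    intro x hx hxr
    refine Nat.le_log_of_pow_le one_lt_two ((Nat.two_pow_le_xor_iff_div_lt_div hab _).2 ?_)
    refine lt_of_lt_of_le ?_ (Nat.div_le_div_right hxr)
    exact Nat.div_lt_div_of_lt_of_dvd pow_padicValNat_dvd (by omega)
  refine ⟨?_, upper⟩
  set k := Nat.log 2 ((ℓ - 1) ^^^ r)
  have hlt : (ℓ - 1) / 2 ^ k < r / 2 ^ k :=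
    (Nat.two_pow_le_xor_iff_div_lt_div hab k).1 (Nat.pow_log_le_self 2 hne)
  have hf : ℓ ≤ r / 2 ^ k * 2 ^ k := by
    have := (Nat.div_lt_iff_lt_mul (by positivity)).1 hlt
    omega
  have hfr : r / 2 ^ k * 2 ^ k ≤ r := Nat.div_mul_le_self _ _
  refine ⟨r / 2 ^ k * 2 ^ k, hf, hfr, le_antisymm (upper _ hf hfr) ?_⟩
  exact (padicValNat_dvd_iff_le (by omega)).1 (dvd_mul_left _ _)
end

section
/- Let ℓ, r be natural numbers with 0 < ℓ ≤ r and let f with ℓ ≤ f ≤ r satisfy padicValNat 2 x ≤ padicValNat 2 f for all x with ℓ ≤ x ≤ r (i.e., f is the 2-fattest number of [ℓ..r]). Then f - ℓ < 2^(padicValNat 2 f) and r - f < 2^(padicValNat 2 f); that is, the 2-fattest number of an interval lies within distance strictly less than 2^(its 2-adic valuation) of both endpoints. -/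
/-- The 2-fattest number of an interval `[ℓ..r]` of positive integers lies
within distance strictly less than `2^(its 2-adic valuation)` of both
endpoints. -/
theorem two_fattest_close_to_endpoints (ℓ r f : ℕ) (hℓ : 0 < ℓ) (hlr : ℓ ≤ r)
    (hfl : ℓ ≤ f) (hfr : f ≤ r)
    (hmax : ∀ x, ℓ ≤ x → x ≤ r → padicValNat 2 x ≤ padicValNat 2 f) :
    f - ℓ < 2 ^ padicValNat 2 f ∧ r - f < 2 ^ padicValNat 2 f := by
  have hndvd : ¬ 2 ^ (padicValNat 2 f + 1) ∣ f :=
    pow_succ_padicValNat_not_dvd (by omega)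
  have hdvd : 2 ^ padicValNat 2 f ∣ f := pow_padicValNat_dvd
  have hmax' : ∀ x, ℓ ≤ x → x ≤ r → ¬ 2 ^ (padicValNat 2 f + 1) ∣ x := by
    intro x hx hxr hd
    have := (padicValNat_dvd_iff_le (p := 2) (by omega : x ≠ 0)).1 hd
    have := hmax x hx hxr
    omega
  generalize padicValNat 2 f = v at hndvd hdvd hmax' ⊢
  obtain ⟨m, hm⟩ := hdvd
  obtain ⟨k, rfl⟩ : Odd m := by
    by_contra h
    obtain ⟨k, rfl⟩ := (Nat.not_odd_iff_even.1 h).two_dvd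
    exact hndvd ⟨k, by rw [hm]; ring⟩
  constructor <;> by_contra! h
  · refine hmax' (f - 2 ^ v) (by omega) (by omega) ⟨k, ?_⟩
    rw [hm, Nat.sub_eq_iff_eq_add (hm ▸ by omega)]
    ring
  · exact hmax' (f + 2 ^ v) (by omega) (by omega) ⟨k + 1, by rw [hm]; ring⟩
end

section
/- Let ℓ, r be natural numbers with 0 < ℓ ≤ r and let f be the 2-fattest number of [ℓ..r] (ℓ ≤ f ≤ r and padicValNat 2 x ≤ padicValNat 2 f for all x ∈ [ℓ..r]). If f < r and f' is the 2-fattest number of the subinterval [f+1..r], then padicValNat 2 f' < padicValNat 2 f; likewise, if ℓ < f and f'' is the 2-fattest number of the subinterval [ℓ..f-1], then padicValNat 2 f'' < padicValNat 2 f. (This strict decrease of the valuation on both residual subintervals is what bounds the number of rounds of the z-fast trie search by O(log) of the pattern length.) -/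
/-- Strictly between two positive numbers of equal 2-adic valuation there is a number of larger
2-adic valuation. -/
theorem exists_between_padicValNat_two_lt {a b : ℕ} (ha : 0 < a) (hab : a < b)
    (h : padicValNat 2 a = padicValNat 2 b) :
    ∃ c, a < c ∧ c < b ∧ padicValNat 2 a < padicValNat 2 c := by
  have hb : b ≠ 0 := by omega
  have not_even {x m : ℕ} (hx : x ≠ 0) (hm : x = 2 ^ padicValNat 2 x * m) : m % 2 = 1 := by
    by_contra hm2
    obtain ⟨t, rfl⟩ : 2 ∣ m := by omega
    have hdvd : 2 ^ (padicValNat 2 x + 1) ∣ x := ⟨t, by rw [pow_succ, mul_assoc]; exact hm⟩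
    have := (padicValNat_dvd_iff_le hx).1 hdvd
    omega
  obtain ⟨m, hm⟩ : 2 ^ padicValNat 2 a ∣ a := pow_padicValNat_dvd
  obtain ⟨n, hn⟩ : 2 ^ padicValNat 2 b ∣ b := pow_padicValNat_dvd
  have hm_odd := not_even ha.ne' hm
  have hn_odd := not_even hb hn
  rw [← h] at hn
  generalize padicValNat 2 a = k at *
  have hk : 0 < 2 ^ k := by positivity
  have hmn : m < n := Nat.lt_of_mul_lt_mul_left (a := 2 ^ k) (by omega)
  refine ⟨2 ^ k * (m + 1), ?_, ?_, ?_⟩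
  · rw [hm]
    exact Nat.mul_lt_mul_of_pos_left (by omega) hk
  · rw [hn]
    exact Nat.mul_lt_mul_of_pos_left (by omega) hk
  · obtain ⟨t, ht⟩ : 2 ∣ m + 1 := by omega
    exact (padicValNat_dvd_iff_le (by positivity)).1 ⟨t, by rw [ht, pow_succ, mul_assoc]⟩

/-- If `f` is the 2-fattest number of `[ℓ..r]`, then the 2-fattest numbers of
the residual subintervals `[f+1..r]` and `[ℓ..f-1]` have strictly smaller
2-adic valuation than `f`. -/
theorem residual_valuation_lt (ℓ r f : ℕ) (hℓ : 0 < ℓ) (hlr : ℓ ≤ r)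
    (hfl : ℓ ≤ f) (hfr : f ≤ r)
    (hmax : ∀ x, ℓ ≤ x → x ≤ r → padicValNat 2 x ≤ padicValNat 2 f) :
    (∀ f', f < r → f + 1 ≤ f' → f' ≤ r →
      (∀ x, f + 1 ≤ x → x ≤ r → padicValNat 2 x ≤ padicValNat 2 f') →
      padicValNat 2 f' < padicValNat 2 f) ∧
    (∀ f'', ℓ < f → ℓ ≤ f'' → f'' ≤ f - 1 →
      (∀ x, ℓ ≤ x → x ≤ f - 1 → padicValNat 2 x ≤ padicValNat 2 f'') →
      padicValNat 2 f'' < padicValNat 2 f) := by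
  constructor
  · intro f' _ hff' hf'r _
    refine lt_of_le_of_ne (hmax f' (by omega) hf'r) fun heq => ?_
    obtain ⟨c, hc₁, hc₂, hc⟩ :=
      exists_between_padicValNat_two_lt (by omega) (by omega : f < f') heq.symm
    exact hc.not_ge (hmax c (by omega) (by omega))
  · intro f'' _ hlf'' hf''f _
    refine lt_of_le_of_ne (hmax f'' hlf'' (by omega)) fun heq => ?_
    obtain ⟨c, hc₁, hc₂, hc⟩ :=
      exists_between_padicValNat_two_lt (by omega) (by omega : f'' < f) heq
    exact (heq ▸ hc).not_ge (hmax c (by omega) (by omega))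
end

section
/- Let ℓ, r be natural numbers with 0 < ℓ ≤ r and let f be the 2-fattest number of [ℓ..r] (ℓ ≤ f ≤ r and padicValNat 2 x ≤ padicValNat 2 f for all x ∈ [ℓ..r]). Then 2^(Nat.log 2 (r - ℓ + 1)) divides f; equivalently, padicValNat 2 f ≥ ⌊log₂(r - ℓ + 1)⌋, so the 2-adic valuation of the 2-fattest number of an interval is at least the floor of the base-2 logarithm of the interval's length. -/
/-- The 2-adic valuation of the 2-fattest number of an interval `[ℓ..r]` of
positive integers is at least `⌊log₂(r - ℓ + 1)⌋`: the 2-fattest number is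
divisible by `2 ^ Nat.log 2 (r - ℓ + 1)`. -/
theorem two_fattest_dvd_pow_log_length (ℓ r f : ℕ) (hℓ : 0 < ℓ) (hlr : ℓ ≤ r)
    (hfl : ℓ ≤ f) (hfr : f ≤ r)
    (hmax : ∀ x, ℓ ≤ x → x ≤ r → padicValNat 2 x ≤ padicValNat 2 f) :
    2 ^ Nat.log 2 (r - ℓ + 1) ∣ f := by
  have hpow : 2 ^ Nat.log 2 (r - ℓ + 1) ≤ r - ℓ + 1 := Nat.pow_log_le_self 2 (by omega)
  have hpos : 0 < 2 ^ Nat.log 2 (r - ℓ + 1) := by positivity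
  have hdiv := Nat.div_add_mod r (2 ^ Nat.log 2 (r - ℓ + 1))
  have hmod := Nat.mod_lt r hpos
  have hle := hmax (2 ^ Nat.log 2 (r - ℓ + 1) * (r / 2 ^ Nat.log 2 (r - ℓ + 1)))
    (by omega) (by omega)
  rw [padicValNat_dvd_iff_le (by omega)]
  refine le_trans ?_ hle
  rw [← padicValNat_dvd_iff_le (by omega)]
  exact dvd_mul_right _ _
end

section
/- Let α be a type and let K be a finite set of lists over α with cardinality k ≥ 1. Then the set { lcp x y | x ∈ K, y ∈ K, x ≠ y } of longest common prefixes of distinct pairs of elements of K has cardinality at most k - 1. (These longest common prefixes are exactly the extents of the internal branching nodes of the compact trie on K, so a compact trie on k keywords has at most k - 1 branching nodes.) -/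
/-- The longest common prefix of two lists: the unique common prefix of `x` and
`y` of which every common prefix of `x` and `y` is a prefix; equivalently,
`x.take m` where `m` is the largest `n` with `x.take n = y.take n`. -/
def lcp {α : Type*} [DecidableEq α] : List α → List α → List α
  | a :: x, b :: y => if a = b then a :: lcp x y else []
  | _, _ => []

theorem lcp_comm {α : Type*} [DecidableEq α] (x y : List α) : lcp x y = lcp y x := by
  induction x generalizing y with
  | nil => cases y <;> simp [lcp]
  | cons a x ih => cases y <;> grind [lcp]

theorem lcp_eq_or_eq_of_length_le {α : Type*} [DecidableEq α] (x y z : List α)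
    (h : (lcp x y).length ≤ (lcp x z).length) : lcp x y = lcp x z ∨ lcp x y = lcp y z := by
  induction x generalizing y z with
  | nil => left; simp [lcp]
  | cons a x ih => cases y <;> cases z <;> grind [lcp]

/-- Adding a list `x` to `K` creates at most one new longest common prefix: the longest one
that `x` has with an element of `K`. -/
theorem exists_image_lcp_insert_subset {α : Type*} [DecidableEq α] (K : Finset (List α))
    (hK : K.Nonempty) (x : List α) :
    ∃ m, (((insert x K ×ˢ insert x K).filter fun p => p.1 ≠ p.2).image fun p => lcp p.1 p.2) ⊆
      insert m (((K ×ˢ K).filter fun p => p.1 ≠ p.2).image fun p => lcp p.1 p.2) := by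
  obtain ⟨z, hz, hmax⟩ := K.exists_max_image (fun y => (lcp x y).length) hK
  have key (y : List α) (hy : y ∈ K) : lcp x y ∈
      insert (lcp x z) (((K ×ˢ K).filter fun p => p.1 ≠ p.2).image fun p => lcp p.1 p.2) := by
    by_cases hyz : y = z
    · simp [hyz]
    · rcases lcp_eq_or_eq_of_length_le x y z (hmax y hy) with h | h
      · simp [h]
      · exact Finset.mem_insert_of_mem
          (Finset.mem_image.2 ⟨(y, z), by simp [hy, hz, hyz], h.symm⟩)
  refine ⟨lcp x z, fun l hl => ?_⟩
  obtain ⟨⟨u, v⟩, huv, rfl⟩ := Finset.mem_image.1 hl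
  simp only [Finset.mem_filter, Finset.mem_product, Finset.mem_insert] at huv
  obtain ⟨⟨rfl | hu, rfl | hv⟩, hne⟩ := huv
  · exact absurd rfl hne
  · exact key v hv
  · exact lcp_comm v u ▸ key u hu
  · exact Finset.mem_insert_of_mem
      (Finset.mem_image.2 ⟨(u, v), by simp [hu, hv, hne], rfl⟩)

/-- The set of longest common prefixes of distinct pairs of elements of a
finite set `K` of `k ≥ 1` lists has cardinality at most `k - 1`. -/
theorem card_lcp_le (α : Type*) [DecidableEq α] (K : Finset (List α))
    (hK : 1 ≤ K.card) :
    (((K ×ˢ K).filter fun p => p.1 ≠ p.2).image fun p => lcp p.1 p.2).card ≤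
      K.card - 1 := by
  induction K using Finset.induction_on with
  | empty => simp at hK
  | insert x K hx ih =>
    rcases K.eq_empty_or_nonempty with rfl | hne
    · simp [Finset.filter_singleton]
    · obtain ⟨m, hm⟩ := exists_image_lcp_insert_subset K hne x
      have hcard := (Finset.card_le_card hm).trans (Finset.card_insert_le _ _)
      have hpos := hne.card_pos
      have := ih hpos
      rw [Finset.card_insert_of_notMem hx]
      omega
end

section
/- Let α be a type, let K be a finite set of lists over α, and let N = K ∪ { lcp x y | x ∈ K, y ∈ K, x ≠ y }. Then N is closed under longest common prefixes: for all u, v ∈ N, lcp u v ∈ N. (That is, the set of node extents of the compact trie on K — keywords together with pairwise longest common prefixes — is closed under taking longest common prefixes.) -/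
theorem lcp_self {α : Type*} [DecidableEq α] (x : List α) : lcp x x = x := by
  induction x with
  | nil => simp [lcp]
  | cons a x ih => simp [lcp, ih]

theorem lcp_assoc {α : Type*} [DecidableEq α] (x y z : List α) :
    lcp (lcp x y) z = lcp x (lcp y z) := by
  induction x generalizing y z with
  | nil => simp [lcp]
  | cons a x ih => cases y <;> cases z <;> grind [lcp]

/-- Both `lcp x y` and `lcp x z` are prefixes of `x`, so the shorter one is the
longest common prefix of all three lists. -/
theorem lcp_lcp_eq_or {α : Type*} [DecidableEq α] (x y z : List α) :
    lcp (lcp x y) z = lcp x y ∨ lcp (lcp x y) z = lcp x z := by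
  induction x generalizing y z with
  | nil => simp [lcp]
  | cons a x ih => cases y <;> cases z <;> grind [lcp]

/-- The set of node extents of the compact trie on a finite set `K` of lists —
the keywords together with the pairwise longest common prefixes of distinct
keywords — is closed under taking longest common prefixes. -/
theorem nodes_closed_under_lcp (α : Type*) [DecidableEq α] (K : Finset (List α))
    (N : Finset (List α))
    (hN : N = K ∪ ((K ×ˢ K).filter fun p => p.1 ≠ p.2).image fun p => lcp p.1 p.2) :
    ∀ u ∈ N, ∀ v ∈ N, lcp u v ∈ N := by
  have mem_iff : ∀ u, u ∈ N ↔ ∃ x ∈ K, ∃ y ∈ K, lcp x y = u := by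
    intro u
    simp only [hN, Finset.mem_union, Finset.mem_image, Finset.mem_filter,
      Finset.mem_product, Prod.exists]
    constructor
    · rintro (hu | ⟨x, y, ⟨⟨hx, hy⟩, -⟩, rfl⟩)
      · exact ⟨u, hu, u, hu, lcp_self u⟩
      · exact ⟨x, hx, y, hy, rfl⟩
    · rintro ⟨x, hx, y, hy, rfl⟩
      by_cases hxy : x = y
      · subst hxy
        exact Or.inl ((lcp_self x).symm ▸ hx)
      · exact Or.inr ⟨x, y, ⟨⟨hx, hy⟩, hxy⟩, rfl⟩
  have lcp_mem : ∀ u ∈ N, ∀ z ∈ K, lcp u z ∈ N := by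
    intro u hu z hz
    obtain ⟨x, hx, y, hy, rfl⟩ := (mem_iff u).1 hu
    rcases lcp_lcp_eq_or x y z with h | h
    · rwa [h]
    · exact (mem_iff _).2 ⟨x, hx, z, hz, h.symm⟩
  intro u hu v hv
  obtain ⟨z, hz, w, hw, rfl⟩ := (mem_iff v).1 hv
  rw [← lcp_assoc]
  exact lcp_mem _ (lcp_mem u hu z hz) w hw
end
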